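/- Let p be a homogeneous polynomial on ℝ² that is biharmonic (Δ²p = 0). Suppose L₁ and L₂ are two distinct lines through the origin, and both p and its gradient ∇p vanish identically on L₁ ∪ L₂. Then p ≡ 0. -/

import Mathlib

open MvPolynomial

/-- Polynomial Laplacian Δp = Σᵢ ∂²p/∂xᵢ². -/
noncomputable def polyLap (p : MvPolynomial (Fin 2) ℝ) : MvPolynomial (Fin 2) ℝ :=
  ∑ i : Fin 2, pderiv i (pderiv i p)

namespace BH

lemma geom_lt (m : ℕ) (hm : 2 ≤ m) (w : ℂ) (hw : ‖w‖ = 1) (h1 : w ≠ 1) :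
    ‖∑ i ∈ Finset.range m, w ^ i‖ < m := by
  induction m, hm using Nat.le_induction with
  | base =>
    simp only [Finset.sum_range_succ, Finset.sum_range_zero, pow_zero, pow_one, zero_add]
    have := norm_add_lt_of_not_sameRay (x := (1 : ℂ)) (y := w) (by
      intro h
      have := (sameRay_iff_of_norm_eq (by simp [hw])).1 h
      exact h1 this.symm)
    simp only [norm_one, hw] at this
    norm_num at this ⊢
    exact this
  | succ m hm ih =>
    rw [Finset.sum_range_succ]
    refine (norm_add_le _ _).trans_lt ?_
    rw [norm_pow, hw]; push_cast; simpa using ih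

lemma lin0 (m : ℕ) (hm : 1 ≤ m) (w : ℂ) (hw : ‖w‖ = 1) (h1 : w ≠ 1) (a b c d : ℂ)
    (e1 : a + b + c + d = 0) (e2 : b + (m + 1 : ℕ) * c + (m + 2 : ℕ) * d = 0)
    (e3 : a + b * w + c * w ^ (m + 1) + d * w ^ (m + 2) = 0)
    (e4 : b + (m + 1 : ℕ) * c * w ^ m + (m + 2 : ℕ) * d * w ^ (m + 1) = 0) :
    a = 0 ∧ b = 0 ∧ c = 0 ∧ d = 0 := by
  have hg := geom_lt (m + 1) (by omega) w hw h1
  have hS := geom_sum_mul w (m + 1)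
  set S := ∑ i ∈ Finset.range (m + 1), w ^ i
  have hP : ‖w ^ m‖ = 1 := by rw [norm_pow, hw, one_pow]
  have hdet : S ^ 2 - ((m + 1 : ℕ) : ℂ) ^ 2 * w ^ m ≠ 0 := by
    intro h
    have h2 : ‖S‖ ^ 2 = ((m + 1 : ℕ) : ℝ) ^ 2 := by
      rw [← norm_pow, sub_eq_zero.1 h, norm_mul, hP, norm_pow, Complex.norm_natCast, mul_one]
    have := norm_nonneg S
    nlinarith
  have hw1 : w - 1 ≠ 0 := sub_ne_zero.2 h1
  have hD : (w * w ^ m - 1) ^ 2 - ((m : ℂ) + 1) ^ 2 * w ^ m * (w - 1) ^ 2 ≠ 0 := by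
    have : (w * w ^ m - 1) ^ 2 - ((m : ℂ) + 1) ^ 2 * w ^ m * (w - 1) ^ 2
        = (S ^ 2 - ((m + 1 : ℕ) : ℂ) ^ 2 * w ^ m) * (w - 1) ^ 2 := by
      rw [← pow_succ', ← hS]; push_cast; ring
    rw [this]
    exact mul_ne_zero hdet (pow_ne_zero 2 hw1)
  have p1 : w ^ (m + 1) = w * w ^ m := pow_succ' w m
  have p2 : w ^ (m + 2) = w * w * w ^ m := by ring
  rw [p1, p2] at e3
  rw [p1] at e4
  push_cast at e2 e4
  generalize w ^ m = P at *
  generalize (m : ℂ) = k at *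
  have hb : b = -(k + 1) * c - (k + 2) * d := by linear_combination e2
  have ha : a = k * c + (k + 1) * d := by linear_combination e1 - hb
  subst hb ha
  have hc : c * ((w * P - 1) ^ 2 - (k + 1) ^ 2 * P * (w - 1) ^ 2) = 0 := by
    linear_combination (k + 2) * (w * P - 1) * e3 - (k + 1 - (k + 2) * w + w * w * P) * e4
  have hd : d * ((w * P - 1) ^ 2 - (k + 1) ^ 2 * P * (w - 1) ^ 2) = 0 := by
    linear_combination (k - (k + 1) * w + w * P) * e4 - (k + 1) * (P - 1) * e3
  have hc := (mul_eq_zero.1 hc).resolve_right hD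
  have hd := (mul_eq_zero.1 hd).resolve_right hD
  subst hc hd
  simp

/-- Substitution `x = (z+w)/2`, `y = (z-w)/(2i)`. -/
noncomputable def phi : MvPolynomial (Fin 2) ℝ →ₐ[ℝ] MvPolynomial (Fin 2) ℂ :=
  aeval ![C (1 / 2) * (X 0 + X 1), C (-Complex.I / 2) * (X 0 - X 1)]

lemma phi_X0 : phi (X 0) = C (1 / 2) * (X 0 + X 1) := by simp [phi]
lemma phi_X1 : phi (X 1) = C (-Complex.I / 2) * (X 0 - X 1) := by simp [phi]
lemma phi_C (r : ℝ) : phi (C r) = C (r : ℂ) := by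
  simp only [phi, algHom_C]; rfl

lemma d0 (p : MvPolynomial (Fin 2) ℝ) : pderiv 0 (phi p) =
    C (1 / 2) * phi (pderiv 0 p) + C (-Complex.I / 2) * phi (pderiv 1 p) := by
  induction p using MvPolynomial.induction_on with
  | C a => simp
  | add p q hp hq => simp only [map_add, hp, hq]; ring
  | mul_X p i hp =>
    fin_cases i <;>
    simp [hp, phi_X0, phi_X1, Derivation.leibniz, pderiv_X] <;> ring

lemma d1 (p : MvPolynomial (Fin 2) ℝ) : pderiv 1 (phi p) =
    C (1 / 2) * phi (pderiv 0 p) - C (-Complex.I / 2) * phi (pderiv 1 p) := by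
  induction p using MvPolynomial.induction_on with
  | C a => simp
  | add p q hp hq => simp only [map_add, hp, hq]; ring
  | mul_X p i hp =>
    fin_cases i <;>
    simp [hp, phi_X0, phi_X1, Derivation.leibniz, pderiv_X] <;> ring

lemma eval_phi (v : Fin 2 → ℝ) (p : MvPolynomial (Fin 2) ℝ) :
    eval ![(v 0 : ℂ) + v 1 * Complex.I, (v 0 : ℂ) - v 1 * Complex.I] (phi p) = (eval v p : ℝ) := by
  induction p using MvPolynomial.induction_on with
  | C a => simp
  | add p q hp hq => simp only [map_add, hp, hq, Complex.ofReal_add]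
  | mul_X p i hp =>
    rw [map_mul, map_mul, hp, map_mul, Complex.ofReal_mul]
    congr 1
    fin_cases i
    · simp [phi_X0]; ring
    · simp [phi_X1]; ring_nf; simp

lemma lap (p : MvPolynomial (Fin 2) ℝ) :
    pderiv 0 (pderiv 1 (phi p)) = C (1 / 4) * phi (polyLap p) := by
  have hI : (C (-Complex.I / 2) : MvPolynomial (Fin 2) ℂ) ^ 2 = - C (1 / 4) := by
    rw [← C_pow, ← C_neg]; congr 1; ring_nf; simp; norm_num
  have h2 : (C (1 / 2) : MvPolynomial (Fin 2) ℂ) ^ 2 = C (1 / 4) := by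
    rw [← C_pow]; congr 1; norm_num
  have hc : pderiv 0 (pderiv 1 p) = pderiv 1 (pderiv 0 p) := by
    ext m
    simp only [coeff_pderiv]
    rw [add_right_comm]
    simp
    ring
  rw [d1, map_sub, pderiv_C_mul, pderiv_C_mul, d0, d0, hc]
  simp only [polyLap, Fin.sum_univ_two, map_add]
  linear_combination (phi (pderiv 0 (pderiv 0 p))) * h2 - (phi (pderiv 1 (pderiv 1 p))) * hI

lemma phi_hom (n : ℕ) (p : MvPolynomial (Fin 2) ℝ) (hp : p.IsHomogeneous n) :
    (phi p).IsHomogeneous n := by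
  have := hp.aeval (τ := Fin 2) (S := ℂ) (n := 1) ![C (1 / 2) * (X 0 + X 1), C (-Complex.I / 2) * (X 0 - X 1)] (by
    intro i
    fin_cases i
    · simpa using ((isHomogeneous_C (Fin 2) (1/2:ℂ)).mul ((isHomogeneous_X ℂ (0:Fin 2)).add (isHomogeneous_X ℂ 1)))
    · simpa using ((isHomogeneous_C (Fin 2) (-Complex.I/2:ℂ)).mul ((isHomogeneous_X ℂ (0:Fin 2)).sub (isHomogeneous_X ℂ 1))))
  simpa [phi] using this


lemma coeff_mid (q : MvPolynomial (Fin 2) ℂ)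
    (h : pderiv 0 (pderiv 1 (pderiv 0 (pderiv 1 q))) = 0) (i j : ℕ) :
    coeff (Finsupp.single 0 (i + 2) + Finsupp.single 1 (j + 2)) q = 0 := by
  have := congrArg (coeff (Finsupp.single 0 i + Finsupp.single 1 j)) h
  simp only [coeff_pderiv, MvPolynomial.coeff_zero] at this
  have e : (Finsupp.single 0 i + Finsupp.single 1 j + Finsupp.single 0 1 + Finsupp.single 1 1 +
      Finsupp.single 0 1 + Finsupp.single 1 1 : Fin 2 →₀ ℕ) =
      Finsupp.single 0 (i + 2) + Finsupp.single 1 (j + 2) := by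
    ext k; fin_cases k <;> simp
  rw [e] at this
  simp only [mul_eq_zero] at this
  have hne : ∀ k : ℕ, (k : ℂ) + 1 ≠ 0 := fun k => by exact_mod_cast Nat.succ_ne_zero k
  have hne2 : ∀ k : ℕ, (k : ℂ) + 1 + 1 ≠ 0 := fun k => by
    exact_mod_cast Nat.succ_ne_zero (k + 1)
  simpa [hne, hne2] using this

lemma expand (n : ℕ) (q : MvPolynomial (Fin 2) ℂ) (hq : q.IsHomogeneous n) :
    q = ∑ k ∈ Finset.range (n + 1),
      C (coeff (Finsupp.single 0 (n - k) + Finsupp.single 1 k) q) * X 0 ^ (n - k) * X 1 ^ k := by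
  have hm : ∀ (a : ℂ) (i j : ℕ), C a * X 0 ^ i * X 1 ^ j =
      monomial (Finsupp.single (0 : Fin 2) i + Finsupp.single 1 j) a := by
    intro a i j
    rw [X_pow_eq_monomial, X_pow_eq_monomial, mul_assoc, monomial_mul, C_mul_monomial]
    simp
  simp only [hm]
  ext m
  have em : m = Finsupp.single 0 (m 0) + Finsupp.single 1 (m 1) := by
    ext k; fin_cases k <;> simp
  rw [coeff_sum]
  simp only [coeff_monomial]
  by_cases h : m 0 + m 1 = n
  · rw [Finset.sum_eq_single (m 1)]
    · have : n - m 1 = m 0 := by omega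
      rw [this, ← em]; simp
    · intro k _ hk
      rw [if_neg]
      intro h'
      apply hk
      rw [← h']; simp
    · intro h'
      exact absurd (Finset.mem_range.2 (by omega)) h'
  · rw [hq.coeff_eq_zero, Finset.sum_eq_zero]
    · intro k hk
      have := Finset.mem_range.1 hk
      rw [if_neg]
      intro h'
      apply h
      rw [← h']; simp; omega
    · rw [em]; simpa [Finsupp.degree_eq_sum] using h

lemma lin (m : ℕ) (hm : 1 ≤ m) (z w z' w' : ℂ) (hz : z ≠ 0) (hz' : z' ≠ 0)
    (hw : ‖w‖ = ‖z‖) (hw' : ‖w'‖ = ‖z'‖) (hne : w' * z ≠ w * z') (a b c d : ℂ)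
    (e1 : a * z ^ (m + 2) + b * z ^ (m + 1) * w + c * z * w ^ (m + 1) + d * w ^ (m + 2) = 0)
    (e2 : b * z ^ (m + 1) + (m + 1 : ℕ) * c * z * w ^ m + (m + 2 : ℕ) * d * w ^ (m + 1) = 0)
    (e3 : a * z' ^ (m + 2) + b * z' ^ (m + 1) * w' + c * z' * w' ^ (m + 1)
      + d * w' ^ (m + 2) = 0)
    (e4 : b * z' ^ (m + 1) + (m + 1 : ℕ) * c * z' * w' ^ m
      + (m + 2 : ℕ) * d * w' ^ (m + 1) = 0) :
    a = 0 ∧ b = 0 ∧ c = 0 ∧ d = 0 := by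
  have hnz : ‖z‖ ≠ 0 := norm_ne_zero_iff.2 hz
  have hnz' : ‖z'‖ ≠ 0 := norm_ne_zero_iff.2 hz'
  obtain ⟨u, rfl⟩ : ∃ u, w = u * z := ⟨w / z, by field_simp⟩
  have hu : ‖u‖ = 1 := by
    rw [norm_mul] at hw
    exact mul_right_cancel₀ hnz (by rw [hw, one_mul])
  have hu0 : u ≠ 0 := by rintro rfl; simp at hu
  obtain ⟨t, rfl⟩ : ∃ t, w' = t * u * z' := ⟨w' / z' / u, by field_simp⟩
  have ht : ‖t‖ = 1 := by
    rw [norm_mul, norm_mul, hu, mul_one] at hw'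
    exact mul_right_cancel₀ hnz' (by rw [hw', one_mul])
  have ht1 : t ≠ 1 := by
    rintro rfl
    apply hne; ring
  obtain ⟨h1, h2, h3, h4⟩ := lin0 m hm t ht ht1 a (b * u) (c * u ^ (m + 1)) (d * u ^ (m + 2))
    (mul_right_cancel₀ (pow_ne_zero (m + 2) hz) (by rw [zero_mul, ← e1]; ring))
    (mul_right_cancel₀ (pow_ne_zero (m + 1) hz) (by
      rw [zero_mul]; linear_combination u * e2))
    (mul_right_cancel₀ (pow_ne_zero (m + 2) hz') (by rw [zero_mul, ← e3]; ring))
    (mul_right_cancel₀ (pow_ne_zero (m + 1) hz') (by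
      rw [zero_mul]; linear_combination u * e4))
  refine ⟨h1, ?_, ?_, ?_⟩
  · simpa [hu0] using h2
  · simpa [hu0] using h3
  · simpa [hu0] using h4

set_option maxHeartbeats 1000000 in
lemma main (n : ℕ) (q : MvPolynomial (Fin 2) ℂ) (hq : q.IsHomogeneous n)
    (h : pderiv 0 (pderiv 1 (pderiv 0 (pderiv 1 q))) = 0)
    (z w z' w' : ℂ) (hz : z ≠ 0) (hz' : z' ≠ 0)
    (hw : ‖w‖ = ‖z‖) (hw' : ‖w'‖ = ‖z'‖) (hne : w' * z ≠ w * z')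
    (e1 : eval ![z, w] q = 0) (e2 : eval ![z, w] (pderiv 1 q) = 0)
    (e3 : eval ![z', w'] q = 0) (e4 : eval ![z', w'] (pderiv 1 q) = 0) : q = 0 := by
  have hc := coeff_mid q h
  have hx := expand n q hq
  generalize hf : (fun k => coeff (Finsupp.single 0 (n - k) + Finsupp.single 1 k) q) = f at hx
  have hf' : ∀ k, coeff (Finsupp.single 0 (n - k) + Finsupp.single 1 k) q = f k :=
    fun k => congrFun hf k
  simp only [hf'] at hx
  clear hf
  obtain rfl | rfl | rfl | ⟨m', rfl⟩ : n = 0 ∨ n = 1 ∨ n = 2 ∨ ∃ m', n = m' + 3 := by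
    rcases n with _ | _ | _ | k
    · simp
    · simp
    · simp
    · exact Or.inr (Or.inr (Or.inr ⟨k, rfl⟩))
  · simp at hx
    rw [hx] at e1
    simp at e1
    rw [hx, e1]; simp
  · simp [Finset.sum_range_succ] at hx
    rw [hx] at e1 e2
    simp [pderiv_X, Derivation.leibniz] at e1 e2
    simp [e2, hz] at e1
    rw [hx, e1, e2]; simp
  · simp [Finset.sum_range_succ] at hx
    rw [hx] at e1 e2 e3 e4
    simp [pderiv_X, Derivation.leibniz, Derivation.leibniz_pow] at e1 e2 e3 e4
    have h2 : f 2 = 0 := by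
      have : f 2 * (w' * z - w * z') = 0 := by linear_combination (z * e4 - z' * e2) / 2
      exact (mul_eq_zero.1 this).resolve_right (sub_ne_zero.2 hne)
    simp [h2, hz] at e2
    simp [h2, hz, e2] at e1
    rw [hx, e1, e2, h2]; simp
  · obtain ⟨m, hm⟩ : ∃ m, m = m' + 1 := ⟨_, rfl⟩
    have hmid : ∀ k ∈ Finset.range m', f (k + 1 + 1) = 0 := by
      intro k hk
      have := Finset.mem_range.1 hk
      rw [← hf', ← hc (m' - 1 - k) k]
      congr 3; omega
    have hx2 : q = C (f 0) * X 0 ^ (m + 2) + C (f 1) * X 0 ^ (m + 1) * X 1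
        + C (f (m + 1)) * X 0 * X 1 ^ (m + 1) + C (f (m + 2)) * X 1 ^ (m + 2) := by
      rw [hx, Finset.sum_range_succ, Finset.sum_range_succ, Finset.sum_range_succ',
        Finset.sum_range_succ', Finset.sum_eq_zero (fun k hk => by rw [hmid k hk]; simp), hm]
      have h1 : m' + 3 - (m' + 2) = 1 := by omega
      simp [h1]
      ring
    clear hx
    rw [hx2] at e1 e2 e3 e4
    simp [pderiv_X, Derivation.leibniz, Derivation.leibniz_pow] at e1 e2 e3 e4
    obtain ⟨h1, h2, h3, h4⟩ := lin m (by omega) z w z' w' hz hz' hw hw' hne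
      (f 0) (f 1) (f (m + 1)) (f (m + 2)) (by linear_combination e1)
      (by push_cast; linear_combination e2) (by linear_combination e3)
      (by push_cast; linear_combination e4)
    rw [hx2, h1, h2, h3, h4]; simp

end BH

/-- A biharmonic homogeneous polynomial on ℝ² whose value and gradient vanish identically
on two distinct lines through the origin is identically zero. -/
theorem biharmonic_homogeneous_two_lines (n : ℕ) (p : MvPolynomial (Fin 2) ℝ)
    (hp_hom : p.IsHomogeneous n) (hp_bih : polyLap (polyLap p) = 0)
    (v₁ v₂ : Fin 2 → ℝ) (hv₁ : v₁ ≠ 0) (hv₂ : v₂ ≠ 0)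
    (hdist : ∀ c : ℝ, v₂ ≠ c • v₁)
    (hp₁ : ∀ t : ℝ, eval (t • v₁) p = 0)
    (hp₂ : ∀ t : ℝ, eval (t • v₂) p = 0)
    (hg₁ : ∀ t : ℝ, ∀ i : Fin 2, eval (t • v₁) (pderiv i p) = 0)
    (hg₂ : ∀ t : ℝ, ∀ i : Fin 2, eval (t • v₂) (pderiv i p) = 0) :
    p = 0 := by
  have key : BH.phi p = 0 := by
    have hnz : ∀ v : Fin 2 → ℝ, v ≠ 0 → (v 0 : ℂ) + v 1 * Complex.I ≠ 0 := by
      intro v hv h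
      apply hv
      have h0 := congrArg Complex.re h
      have h1 := congrArg Complex.im h
      simp at h0 h1
      ext k; fin_cases k <;> simp [h0, h1]
    have hn : ∀ v : Fin 2 → ℝ,
        ‖(v 0 : ℂ) - v 1 * Complex.I‖ = ‖(v 0 : ℂ) + v 1 * Complex.I‖ := by
      intro v
      rw [← Complex.norm_conj]
      simp
    have hd : ∀ v : Fin 2 → ℝ, (∀ i, eval v (pderiv i p) = 0) →
        eval ![(v 0 : ℂ) + v 1 * Complex.I, (v 0 : ℂ) - v 1 * Complex.I]
          (pderiv 1 (BH.phi p)) = 0 := by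
      intro v h
      rw [BH.d1, map_sub, map_mul, map_mul, BH.eval_phi, BH.eval_phi, h, h]
      simp
    refine BH.main n (BH.phi p) (BH.phi_hom n p hp_hom) ?_ _ _ _ _ (hnz v₁ hv₁) (hnz v₂ hv₂)
      (hn v₁) (hn v₂) ?_ ?_ (hd v₁ ?_) ?_ (hd v₂ ?_)
    · rw [BH.lap, pderiv_C_mul, pderiv_C_mul, BH.lap, hp_bih]
      simp
    · intro h
      have him := congrArg Complex.im h
      simp at him
      have hcr : v₂ 0 * v₁ 1 = v₂ 1 * v₁ 0 := by linarith
      by_cases h0 : v₁ 0 = 0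
      · have h1 : v₁ 1 ≠ 0 := by
          intro h1
          apply hv₁
          ext k; fin_cases k <;> simp [h0, h1]
        apply hdist (v₂ 1 / v₁ 1)
        have : v₂ 0 = 0 := by simpa [h0, h1] using hcr
        ext k; fin_cases k <;> simp [h0, h1, this]
      · apply hdist (v₂ 0 / v₁ 0)
        ext k; fin_cases k
        · simp [h0]
        · simp; field_simp; linarith
    · rw [BH.eval_phi]; simpa using hp₁ 1
    · simpa using hg₁ 1
    · rw [BH.eval_phi]; simpa using hp₂ 1
    · simpa using hg₂ 1
  apply MvPolynomial.funext
  intro v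
  have := BH.eval_phi v p
  rw [key, map_zero] at this
  rw [map_zero]
  exact_mod_cast this.symm
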